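/- arXiv:1302.0881 — 3 statements merged into one kernel-verified Lean document; each statement's English description precedes it below -/
import Mathlib

section
/- Let k ≥ 1 and let a ≠ 0 be a real number such that c_k^{−a}(−n) ≠ 0 for all integers n ≥ 1. Define γ_n = c_k^{−a}(−n), β_n = γ_{n+1}/γ_n for n ≥ 1, λ_n = −c_{k+1}^{−a}(−n) for n ≥ 0, and the polynomials q_0 = 1 and q_n(x) = c_n^a(x) + β_n·c_{n−1}^a(x) for n ≥ 1. Let B be the bilinear form on ℝ[X] given by B(p,q) = (−1)^k·k!·p(−k−1)·q(−k−1) + Σ_{x=0}^{∞} [a^{x+k+1}/((x+k+1)·x!)]·p(x)·q(x) (the series converges absolutely). Then: (1) the polynomials (q_n)_n are orthogonal with respect to B, i.e. B(q_n, X^m) = 0 for 0 ≤ m < n and B(q_n, X^n) ≠ 0; and (2) with P₁(x) = −c_{k+1}^{−a}(x), P₂(x) = c_k^{−a}(x−1), and D = P₁(D_a) + ∇ ∘ P₂(D_a), one has D(q_n) = λ_n·q_n for all n ≥ 0. -/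
open Polynomial

/-- The Charlier polynomial `c_n^a(x) = (1/n!) ∑_{j=0}^n (-a)^{n-j} C(n,j) x(x-1)⋯(x-j+1)`. -/
noncomputable def charlier (a : ℝ) (n : ℕ) : ℝ[X] :=
  C ((n.factorial : ℝ))⁻¹ * ∑ j ∈ Finset.range (n+1),
    C ((-a)^(n-j) * (n.choose j : ℝ)) * ∏ i ∈ Finset.range j, (X - C (i : ℝ))

/-- The generating function `∑ x(x-1)⋯(x-j+1)/j! w^j = (1+w)^x`. -/
noncomputable def binomialGenFun (x : ℝ) : PowerSeries ℝ :=
  PowerSeries.mk fun j ↦ (∏ i ∈ Finset.range j, (x - i)) / j.factorial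

/-- The power series of `exp (-a w)`. -/
noncomputable def expNegGenFun (a : ℝ) : PowerSeries ℝ :=
  PowerSeries.mk fun j ↦ (-a) ^ j / j.factorial

lemma eval_charlier (a : ℝ) (n : ℕ) (x : ℝ) :
    (charlier a n).eval x = PowerSeries.coeff n (binomialGenFun x * expNegGenFun a) := by
  rw [PowerSeries.coeff_mul, Finset.Nat.sum_antidiagonal_eq_sum_range_succ_mk]
  simp only [charlier, eval_mul, eval_C, eval_finsetSum, eval_prod, eval_sub, eval_X,
    binomialGenFun, expNegGenFun, PowerSeries.coeff_mk, Finset.mul_sum]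
  refine Finset.sum_congr rfl fun j hj ↦ ?_
  rw [Nat.cast_choose ℝ (Finset.mem_range_succ_iff.mp hj)]
  field_simp

lemma prod_range_succ_sub (x : ℝ) (j : ℕ) :
    ∏ i ∈ Finset.range (j + 1), (x - i) = x * ∏ i ∈ Finset.range j, (x - 1 - i) := by
  rw [Finset.prod_range_succ', mul_comm]
  simp [sub_sub, add_comm]

lemma derivative_binomialGenFun (x : ℝ) :
    PowerSeries.derivative ℝ (binomialGenFun x) = x • binomialGenFun (x - 1) := by
  ext j
  simp only [PowerSeries.coeff_derivative, binomialGenFun, PowerSeries.coeff_mk,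
    PowerSeries.coeff_smul, smul_eq_mul, prod_range_succ_sub, Nat.factorial_succ]
  push_cast
  field_simp

lemma derivative_expNegGenFun (a : ℝ) :
    PowerSeries.derivative ℝ (expNegGenFun a) = (-a) • expNegGenFun a := by
  ext j
  simp only [PowerSeries.coeff_derivative, expNegGenFun, PowerSeries.coeff_mk,
    PowerSeries.coeff_smul, smul_eq_mul, Nat.factorial_succ]
  push_cast
  field_simp
  ring

lemma binomialGenFun_add_one (x : ℝ) :
    binomialGenFun (x + 1) = (1 + PowerSeries.X) * binomialGenFun x := by
  ext j
  rcases j with _ | j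
  · simp [binomialGenFun, add_mul]
  · simp only [add_mul, one_mul, map_add, PowerSeries.coeff_succ_X_mul]
    simp only [binomialGenFun, PowerSeries.coeff_mk, prod_range_succ_sub (x + 1)]
    rw [add_sub_cancel_right, Finset.prod_range_succ, Nat.factorial_succ]
    push_cast
    field_simp
    ring

@[simp] lemma charlier_zero (a : ℝ) : charlier a 0 = 1 := by
  simp [charlier]

lemma eval_charlier_succ_add_one (a : ℝ) (n : ℕ) (x : ℝ) :
    (charlier a (n + 1)).eval (x + 1) =
      (charlier a (n + 1)).eval x + (charlier a n).eval x := by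
  simp only [eval_charlier, binomialGenFun_add_one, add_mul, one_mul, mul_assoc, map_add,
    PowerSeries.coeff_succ_X_mul]

lemma mul_eval_charlier_sub_one (a : ℝ) (n : ℕ) (x : ℝ) :
    x * (charlier a n).eval (x - 1) =
      (n + 1) * (charlier a (n + 1)).eval x + a * (charlier a n).eval x := by
  have h := congrArg (PowerSeries.coeff n)
    ((PowerSeries.derivative ℝ).leibniz (binomialGenFun x) (expNegGenFun a))
  rw [PowerSeries.coeff_derivative, derivative_binomialGenFun, derivative_expNegGenFun] at h
  simp only [smul_eq_mul, mul_smul_comm, map_add, PowerSeries.coeff_smul] at h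
  rw [mul_comm (expNegGenFun a)] at h
  simp only [eval_charlier]
  linarith

lemma eval_charlier_one (a x : ℝ) : (charlier a 1).eval x = x - a := by
  have h := mul_eval_charlier_sub_one a 0 x
  simp at h
  linarith

/-- The three-term recurrence. -/
lemma X_mul_charlier_succ (a : ℝ) (n : ℕ) :
    X * charlier a (n + 1) = (n + 2 : ℝ) • charlier a (n + 2)
      + (n + 1 + a) • charlier a (n + 1) + a • charlier a n := by
  refine Polynomial.funext fun x ↦ ?_
  have h₁ := mul_eval_charlier_sub_one a (n + 1) x
  have h₂ := mul_eval_charlier_sub_one a n x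
  have h₃ := eval_charlier_succ_add_one a n (x - 1)
  rw [sub_add_cancel] at h₃
  simp only [eval_add, eval_mul, eval_X, eval_smul, smul_eq_mul]
  push_cast at h₁
  rw [h₃]
  linear_combination h₁ + h₂ + (n + 1 + a) * h₃

lemma X_mul_charlier_zero (a : ℝ) :
    X * charlier a 0 = charlier a 1 + a • charlier a 0 := by
  refine Polynomial.funext fun x ↦ ?_
  simp [eval_charlier_one]

lemma eval_charlier_difference_equation (a : ℝ) (n : ℕ) (x : ℝ) :
    x * (charlier a n).eval (x - 1) - (x + a) * (charlier a n).eval x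
      + a * (charlier a n).eval (x + 1) = -n * (charlier a n).eval x := by
  rcases n with _ | n
  · simp
  · have h₁ := mul_eval_charlier_sub_one a (n + 1) x
    have h₂ := congrArg (eval x) (X_mul_charlier_succ a n)
    have h₃ := eval_charlier_succ_add_one a n x
    simp only [eval_add, eval_mul, eval_X, eval_smul, smul_eq_mul] at h₂
    push_cast at h₁ ⊢
    linear_combination h₁ - h₂ + a * h₃

lemma charlierOperator_apply (a : ℝ) (Da : Module.End ℝ ℝ[X])
    (hDa : ∀ f : ℝ[X], ∀ x : ℝ,
      (Da f).eval x = x * f.eval (x-1) - (x+a) * f.eval x + a * f.eval (x+1)) (n : ℕ) :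
    Da (charlier a n) = (-(n : ℝ)) • charlier a n :=
  Polynomial.funext fun x ↦ by
    rw [hDa, eval_smul, smul_eq_mul, eval_charlier_difference_equation]

lemma aeval_charlierOperator_apply (a : ℝ) (Da : Module.End ℝ ℝ[X])
    (hDa : ∀ f : ℝ[X], ∀ x : ℝ,
      (Da f).eval x = x * f.eval (x-1) - (x+a) * f.eval x + a * f.eval (x+1))
    (P : ℝ[X]) (n : ℕ) :
    aeval Da P (charlier a n) = P.eval (-(n : ℝ)) • charlier a n :=
  Module.End.aeval_apply_of_mem_apply_eq_smul (charlierOperator_apply a Da hDa n)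

/-- The difference equation of `c_k^{-a}` at the point `-(n+1)`. -/
lemma eval_charlier_neg_recurrence (a : ℝ) (k n : ℕ) :
    ((n : ℝ) + 1) * (charlier (-a) k).eval (-((n : ℝ) + 2)) =
      (n + 1 + a + k) * (charlier (-a) k).eval (-((n : ℝ) + 1))
        - a * (charlier (-a) k).eval (-(n : ℝ)) := by
  have h := eval_charlier_difference_equation (-a) k (-((n : ℝ) + 1))
  rw [show -((n : ℝ) + 1) - 1 = -((n : ℝ) + 2) by ring,
    show -((n : ℝ) + 1) + 1 = -(n : ℝ) by ring] at h
  linear_combination -h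

lemma summable_pow_div_factorial_mul_eval (a : ℝ) (p : ℝ[X]) :
    Summable fun x : ℕ ↦ a ^ x / x.factorial * p.eval (x : ℝ) := by
  induction p using Polynomial.induction_on' with
  | add p q hp hq => simpa [mul_add] using hp.add hq
  | monomial m c =>
    refine Summable.of_norm_bounded
      (((Real.summable_pow_div_factorial (|a| * Real.exp 1)).mul_left (|c| * m.factorial)))
      fun x ↦ ?_
    have h := Real.pow_div_factorial_le_exp (x : ℝ) (by positivity) m
    rw [div_le_iff₀ (by positivity), ← mul_one (x : ℝ), Real.exp_nat_mul, mul_one] at h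
    rw [eval_monomial, norm_mul, norm_mul, norm_div, norm_pow, norm_pow]
    simp only [Real.norm_eq_abs, Nat.abs_cast, mul_pow]
    calc |a| ^ x / x.factorial * (|c| * (x : ℝ) ^ m)
        ≤ |a| ^ x / x.factorial * (|c| * (Real.exp 1 ^ x * m.factorial)) := by gcongr
      _ = _ := by ring

lemma summable_shifted_weight_mul_eval (k : ℕ) (a : ℝ) (p : ℝ[X]) :
    Summable fun x : ℕ ↦
      a ^ (x + k + 1) / (((x : ℝ) + k + 1) * x.factorial) * p.eval (x : ℝ) := by
  refine Summable.of_norm_bounded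
    ((summable_pow_div_factorial_mul_eval a p).norm.mul_left (|a| ^ (k + 1))) fun x ↦ ?_
  have h : (1 : ℝ) ≤ (x : ℝ) + k + 1 := by
    have : (0 : ℝ) ≤ (x : ℝ) + k := by positivity
    linarith
  simp only [norm_mul, norm_div, norm_pow, Real.norm_eq_abs, Nat.abs_cast]
  rw [abs_of_nonneg (by positivity : (0 : ℝ) ≤ (x : ℝ) + k + 1)]
  calc |a| ^ (x + k + 1) / (((x : ℝ) + k + 1) * x.factorial) * |p.eval (x : ℝ)|
      ≤ |a| ^ (x + k + 1) / (1 * x.factorial) * |p.eval (x : ℝ)| := by gcongr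
    _ = _ := by ring

/-- Integration against the weight `∑ a^x/x! δ_x`. -/
noncomputable def charlierFunctional (a : ℝ) : ℝ[X] →ₗ[ℝ] ℝ where
  toFun p := ∑' x : ℕ, a ^ x / x.factorial * p.eval (x : ℝ)
  map_add' p q := by
    simp only [eval_add, mul_add]
    exact (summable_pow_div_factorial_mul_eval a p).tsum_add
      (summable_pow_div_factorial_mul_eval a q)
  map_smul' c p := by
    simp only [eval_smul, smul_eq_mul, RingHom.id_apply, ← tsum_mul_left, mul_left_comm]

/-- Integration against `(-1)^k k! δ_{-k-1} + ∑ a^(x+k+1)/((x+k+1) x!) δ_x`. -/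
noncomputable def krallCharlierFunctional (k : ℕ) (a : ℝ) : ℝ[X] →ₗ[ℝ] ℝ where
  toFun p := (-1) ^ k * k.factorial * p.eval (-(k : ℝ) - 1) + ∑' x : ℕ,
    a ^ (x + k + 1) / (((x : ℝ) + k + 1) * x.factorial) * p.eval (x : ℝ)
  map_add' p q := by
    simp only [eval_add, mul_add]
    rw [(summable_shifted_weight_mul_eval k a p).tsum_add
      (summable_shifted_weight_mul_eval k a q)]
    ring
  map_smul' c p := by
    simp only [eval_smul, smul_eq_mul, RingHom.id_apply, mul_add, ← tsum_mul_left, mul_left_comm]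

lemma tsum_pow_div_factorial (a : ℝ) : ∑' x : ℕ, a ^ x / x.factorial = Real.exp a := by
  rw [Real.exp_eq_exp_ℝ, NormedSpace.exp_eq_tsum_div]

lemma charlierFunctional_one (a : ℝ) : charlierFunctional a 1 = Real.exp a := by
  simp [charlierFunctional, tsum_pow_div_factorial]

lemma charlierFunctional_X_mul (a : ℝ) (p : ℝ[X]) :
    charlierFunctional a (X * p) = a * charlierFunctional a (p.comp (X + 1)) := by
  simp only [charlierFunctional, LinearMap.coe_mk, AddHom.coe_mk]
  rw [(summable_pow_div_factorial_mul_eval a (X * p)).tsum_eq_zero_add, ← tsum_mul_left]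
  simp only [eval_mul, eval_X, Nat.cast_zero, zero_mul, mul_zero, zero_add]
  refine tsum_congr fun x ↦ ?_
  simp only [eval_comp, eval_add, eval_X, eval_one, Nat.factorial_succ]
  push_cast
  field_simp
  ring

lemma charlierFunctional_charlier_succ (a : ℝ) (n : ℕ) :
    charlierFunctional a (charlier a (n + 1)) = 0 := by
  induction n with
  | zero =>
    have h := congrArg (charlierFunctional a) (X_mul_charlier_zero a)
    simp only [charlier_zero, charlierFunctional_X_mul, map_add, map_smul,
      one_comp, smul_eq_mul] at h
    simpa using h
  | succ n ih =>
    have h := congrArg (charlierFunctional a) (X_mul_charlier_succ a n)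
    have hc : (charlier a (n + 1)).comp (X + 1) = charlier a (n + 1) + charlier a n :=
      Polynomial.funext fun x ↦ by simp [eval_charlier_succ_add_one]
    simp only [charlierFunctional_X_mul, map_add, map_smul, smul_eq_mul, hc,
      ih] at h
    have hn : (n + 2 : ℝ) ≠ 0 := by positivity
    refine (mul_eq_zero.mp ?_).resolve_left hn
    linarith

lemma charlierFunctional_charlier_mul_X_pow_of_lt (a : ℝ) {n m : ℕ} (h : m < n) :
    charlierFunctional a (charlier a n * X ^ m) = 0 := by
  induction m generalizing n with
  | zero =>
    obtain ⟨n, rfl⟩ := Nat.exists_eq_succ_of_ne_zero h.ne'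
    simpa using charlierFunctional_charlier_succ a n
  | succ m ih =>
    obtain ⟨n, rfl⟩ := Nat.exists_eq_succ_of_ne_zero (Nat.ne_zero_of_lt h)
    rw [pow_succ', ← mul_assoc, mul_comm _ X, Nat.succ_eq_add_one, X_mul_charlier_succ]
    simp only [add_mul, smul_mul_assoc, map_add, map_smul]
    rw [ih (by omega), ih (by omega), ih (by omega)]
    simp

lemma charlierFunctional_charlier_mul_X_pow_self (a : ℝ) (n : ℕ) :
    charlierFunctional a (charlier a n * X ^ n) = a ^ n * Real.exp a := by
  induction n with
  | zero => simp [charlierFunctional_one]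
  | succ n ih =>
    rw [pow_succ', ← mul_assoc, mul_comm _ X, X_mul_charlier_succ]
    simp only [add_mul, smul_mul_assoc, map_add, map_smul]
    rw [ih, charlierFunctional_charlier_mul_X_pow_of_lt a (by omega),
      charlierFunctional_charlier_mul_X_pow_of_lt a (by omega)]
    simp only [smul_eq_mul]
    ring

lemma krallCharlierFunctional_X_mul (k : ℕ) (a : ℝ) (p : ℝ[X]) :
    krallCharlierFunctional k a (X * p) =
      a ^ (k + 1) * charlierFunctional a p - (k + 1) * krallCharlierFunctional k a p := by
  rw [eq_sub_iff_add_eq, ← smul_eq_mul ((k : ℝ) + 1), ← map_smul, ← map_add]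
  simp only [krallCharlierFunctional, charlierFunctional, LinearMap.coe_mk, AddHom.coe_mk,
    ← tsum_mul_left, eval_mul, eval_add, eval_X, eval_smul, smul_eq_mul, ← add_mul]
  rw [show (-(k : ℝ) - 1 + (k + 1)) = 0 by ring, zero_mul, mul_zero, zero_add]
  refine tsum_congr fun x ↦ ?_
  have : (x : ℝ) + k + 1 ≠ 0 := by positivity
  field_simp
  ring

lemma eval_charlier_neg_zero (a : ℝ) (k : ℕ) :
    (k.factorial : ℝ) * (charlier (-a) k).eval 0 = a ^ k := by
  induction k with
  | zero => simp
  | succ k ih =>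
    have h := mul_eval_charlier_sub_one (-a) k 0
    rw [Nat.factorial_succ, pow_succ, ← ih]
    push_cast
    linear_combination -(k.factorial : ℝ) * h

lemma eval_charlier_neg_one_succ (a : ℝ) (k : ℕ) :
    ((k + 1).factorial : ℝ) * (charlier (-a) (k + 1)).eval (-1) =
      a ^ (k + 1) - (k + 1) * (k.factorial * (charlier (-a) k).eval (-1)) := by
  have h := eval_charlier_succ_add_one (-a) k (-1)
  rw [neg_add_cancel] at h
  rw [← eval_charlier_neg_zero, h, Nat.factorial_succ]
  push_cast
  ring

lemma krallCharlierFunctional_one (k : ℕ) (a : ℝ) :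
    krallCharlierFunctional k a 1 =
      Real.exp a * (k.factorial * (charlier (-a) k).eval (-1)) := by
  simp only [krallCharlierFunctional, LinearMap.coe_mk, AddHom.coe_mk, eval_one, mul_one]
  induction k with
  | zero =>
    have h := (Real.summable_pow_div_factorial a).tsum_eq_zero_add
    rw [tsum_pow_div_factorial] at h
    simp only [pow_zero, Nat.factorial_zero, Nat.cast_one, Nat.cast_zero, add_zero, div_one,
      mul_one, charlier_zero, eval_one] at h ⊢
    rw [h]
    congr 1
    refine tsum_congr fun x ↦ ?_
    rw [Nat.factorial_succ]
    push_cast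
    rfl
  | succ k ih =>
    have hs := summable_shifted_weight_mul_eval k a X
    have h : (k + 1) * ∑' x : ℕ, a ^ (x + k + 1) / (((x : ℝ) + k + 1) * x.factorial) +
        ∑' x : ℕ, a ^ (x + k + 1) / (((x : ℝ) + k + 1) * x.factorial) * eval (x : ℝ) X =
        a ^ (k + 1) * Real.exp a := by
      rw [← tsum_pow_div_factorial, ← tsum_mul_left, ← tsum_mul_left, ← Summable.tsum_add _ hs]
      · refine tsum_congr fun x ↦ ?_
        have : (x : ℝ) + k + 1 ≠ 0 := by positivity
        rw [eval_X]
        field_simp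
        ring
      · simpa using (summable_shifted_weight_mul_eval k a 1).mul_left ((k : ℝ) + 1)
    rw [hs.tsum_eq_zero_add] at h
    have h' : ∑' x : ℕ, a ^ (x + 1 + k + 1) / ((((x + 1 : ℕ) : ℝ) + k + 1) * (x + 1).factorial)
          * eval ((x + 1 : ℕ) : ℝ) X =
        ∑' x : ℕ, a ^ (x + (k + 1) + 1) / (((x : ℝ) + (k + 1 : ℕ) + 1) * x.factorial) := by
      refine tsum_congr fun x ↦ ?_
      rw [eval_X, Nat.factorial_succ, add_right_comm x 1 k, ← add_assoc]
      push_cast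
      have : (x : ℝ) + 1 + k + 1 ≠ 0 := by positivity
      have : (x : ℝ) + (k + 1) + 1 ≠ 0 := by positivity
      field_simp
      ring
    rw [h'] at h
    simp only [Nat.cast_zero, eval_X, mul_zero, zero_add] at h
    rw [eval_charlier_neg_one_succ, mul_sub, mul_left_comm _ ((k : ℝ) + 1), ← ih,
      Nat.factorial_succ, pow_succ]
    push_cast at h ⊢
    linear_combination h

lemma krallCharlierFunctional_charlier (k : ℕ) (a : ℝ) (n : ℕ) :
    krallCharlierFunctional k a (charlier a n) = (-1) ^ n * (Real.exp a * (k.factorial *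
      (charlier (-a) k).eval (-((n : ℝ) + 1)))) := by
  induction n using Nat.twoStepInduction with
  | zero => simpa using krallCharlierFunctional_one k a
  | one =>
    have h := krallCharlierFunctional_X_mul k a (charlier a 0)
    rw [X_mul_charlier_zero] at h
    simp only [map_add, map_smul, smul_eq_mul, charlier_zero,
      charlierFunctional_one, krallCharlierFunctional_one] at h
    have hr := eval_charlier_neg_recurrence a k 0
    have h₀ := eval_charlier_neg_zero a k
    norm_num at hr h₀ ⊢
    linear_combination h + Real.exp a * k.factorial * hr - a * Real.exp a * h₀
  | more n ih₀ ih₁ =>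
    have h := krallCharlierFunctional_X_mul k a (charlier a (n + 1))
    rw [X_mul_charlier_succ, charlierFunctional_charlier_succ] at h
    simp only [map_add, map_smul, smul_eq_mul, ih₀, ih₁] at h
    have hr := eval_charlier_neg_recurrence a k (n + 1)
    have hn : (n + 2 : ℝ) ≠ 0 := by positivity
    refine mul_left_cancel₀ hn ?_
    rw [show -(((n + 1 : ℕ) : ℝ) + 2) = -(((n + 2 : ℕ) : ℝ) + 1) by push_cast; ring,
      show -((n + 1 : ℕ) : ℝ) = -((n : ℝ) + 1) by push_cast; ring] at hr
    rw [pow_succ, pow_succ]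
    rw [pow_succ] at h
    push_cast at h hr ⊢
    linear_combination h - (-1) ^ n * Real.exp a * k.factorial * hr

/-- Theorem 4.4: the polynomials `q_n = c_n^a + β_n c_{n-1}^a` are orthogonal with
respect to `ρ̃_{k,a} = (-1)^k k! δ_{-k-1} + ∑_x a^{x+k+1}/((x+k+1) x!) δ_x`, and are
eigenfunctions of `D = P₁(D_a) + ∇ P₂(D_a)` with `P₁ = -c_{k+1}^{-a}`,
`P₂(x) = c_k^{-a}(x-1)`. -/
theorem stmt7 (k : ℕ) (hk : 1 ≤ k) (a : ℝ) (ha : a ≠ 0)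
    (hnz : ∀ n : ℕ, 1 ≤ n → (charlier (-a) k).eval (-(n : ℝ)) ≠ 0)
    (γ β lam : ℕ → ℝ)
    (hγ : ∀ n : ℕ, γ n = (charlier (-a) k).eval (-(n : ℝ)))
    (hβ : ∀ n : ℕ, 1 ≤ n → β n = γ (n+1) / γ n)
    (hlam : ∀ n : ℕ, lam n = -(charlier (-a) (k+1)).eval (-(n : ℝ)))
    (q : ℕ → ℝ[X]) (hq0 : q 0 = 1)
    (hq : ∀ n : ℕ, q (n+1) = charlier a (n+1) + C (β (n+1)) * charlier a n)
    (B : ℝ[X] → ℝ[X] → ℝ)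
    (hB : ∀ p r : ℝ[X], B p r =
      (-1:ℝ)^k * k.factorial * p.eval (-(k : ℝ) - 1) * r.eval (-(k : ℝ) - 1)
        + ∑' x : ℕ, a^(x+k+1) / (((x : ℝ) + k + 1) * x.factorial)
            * p.eval (x : ℝ) * r.eval (x : ℝ))
    (P₁ P₂ : ℝ[X])
    (hP₁ : P₁ = -(charlier (-a) (k+1)))
    (hP₂ : P₂ = (charlier (-a) k).comp (X - 1))
    (Da : Module.End ℝ ℝ[X])
    (hDa : ∀ f : ℝ[X], ∀ x : ℝ,
      (Da f).eval x = x * f.eval (x-1) - (x+a) * f.eval x + a * f.eval (x+1))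
    (nab : Module.End ℝ ℝ[X])
    (hnab : ∀ f : ℝ[X], ∀ x : ℝ, (nab f).eval x = f.eval x - f.eval (x-1))
    (D : Module.End ℝ ℝ[X])
    (hD : D = aeval Da P₁ + nab * aeval Da P₂) :
    (∀ n m : ℕ, m < n → B (q n) (X^m) = 0) ∧
    (∀ n : ℕ, B (q n) (X^n) ≠ 0) ∧
    (∀ n : ℕ, D (q n) = lam n • q n) := by
  have hB' : ∀ p r, B p r = krallCharlierFunctional k a (p * r) := fun p r ↦ by
    rw [hB]
    simp only [krallCharlierFunctional, LinearMap.coe_mk, AddHom.coe_mk, eval_mul, mul_assoc]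
  have hγ' : ∀ n : ℕ, γ (n + 1) ≠ 0 := fun n ↦ by
    rw [hγ]
    exact hnz _ n.succ_pos
  have hβγ : ∀ n, β (n + 1) * γ (n + 1) = γ (n + 2) := fun n ↦ by
    rw [hβ _ n.succ_pos, div_mul_cancel₀ _ (hγ' n)]
  have hB0 : ∀ n, B (q (n + 1)) 1 = 0 := fun n ↦ by
    rw [hB', mul_one, hq, ← smul_eq_C_mul, map_add, map_smul, krallCharlierFunctional_charlier,
      krallCharlierFunctional_charlier, smul_eq_mul]
    have h₁ := hγ (n + 1)
    have h₂ := hγ (n + 2)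
    have h₃ := hβγ n
    rw [h₁, h₂] at h₃
    push_cast at h₃ ⊢
    rw [show -((n : ℝ) + 1 + 1) = -((n : ℝ) + 2) by ring, ← h₃]
    ring
  have hBsucc : ∀ n m, B (q (n + 1)) (X ^ (m + 1)) =
      a ^ (k + 1) * (charlierFunctional a (charlier a (n + 1) * X ^ m)
        + β (n + 1) * charlierFunctional a (charlier a n * X ^ m))
      - (k + 1) * B (q (n + 1)) (X ^ m) := fun n m ↦ by
    rw [hB', hB', pow_succ', mul_left_comm, krallCharlierFunctional_X_mul]
    congr 2
    rw [hq, add_mul, ← smul_eq_C_mul, smul_mul_assoc, map_add, map_smul, smul_eq_mul]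
  have horth : ∀ n m : ℕ, m < n → B (q n) (X ^ m) = 0 := fun n m hmn ↦ by
    obtain ⟨n, rfl⟩ := Nat.exists_eq_succ_of_ne_zero (Nat.ne_zero_of_lt hmn)
    induction m with
    | zero => simpa using hB0 n
    | succ m ih =>
      rw [Nat.succ_eq_add_one, hBsucc, ih (by omega),
        charlierFunctional_charlier_mul_X_pow_of_lt a (by omega),
        charlierFunctional_charlier_mul_X_pow_of_lt a (by omega)]
      simp
  refine ⟨horth, fun n ↦ ?_, fun n ↦ ?_⟩
  · rcases n with _ | n
    · have h := hγ' 0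
      rw [hγ] at h
      rw [hB', hq0, pow_zero, mul_one, krallCharlierFunctional_one]
      refine mul_ne_zero (Real.exp_ne_zero a) (mul_ne_zero (by positivity) ?_)
      simpa using h
    · rw [hBsucc, horth _ _ n.lt_succ_self,
        charlierFunctional_charlier_mul_X_pow_of_lt a n.lt_succ_self,
        charlierFunctional_charlier_mul_X_pow_self, zero_add, mul_zero, sub_zero]
      refine mul_ne_zero (pow_ne_zero _ ha) (mul_ne_zero ?_
        (mul_ne_zero (pow_ne_zero _ ha) (Real.exp_ne_zero a)))
      rw [hβ _ n.succ_pos]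
      exact div_ne_zero (hγ' _) (hγ' _)
  · have hP₁e : ∀ n : ℕ, P₁.eval (-(n : ℝ)) = lam n := fun n ↦ by rw [hP₁, hlam, eval_neg]
    have hP₂e : ∀ n : ℕ, P₂.eval (-(n : ℝ)) = γ (n + 1) := fun n ↦ by
      rw [hP₂, hγ, eval_comp]
      simp [sub_eq_add_neg, add_comm]
    have hDc : ∀ n, D (charlier a n) = lam n • charlier a n + γ (n + 1) • nab (charlier a n) :=
      fun n ↦ by
        rw [hD, LinearMap.add_apply, Module.End.mul_apply,
          aeval_charlierOperator_apply a Da hDa, aeval_charlierOperator_apply a Da hDa,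
          map_smul, hP₁e, hP₂e]
    have hnab0 : nab (charlier a 0) = 0 := Polynomial.funext fun x ↦ by simp [hnab]
    have hnabs : ∀ n, nab (charlier a (n + 1)) + nab (charlier a n) = charlier a n := fun n ↦ by
      refine Polynomial.funext fun x ↦ ?_
      have h := eval_charlier_succ_add_one a n (x - 1)
      rw [sub_add_cancel] at h
      rw [eval_add, hnab, hnab, h]
      ring
    rcases n with _ | n
    · have h := hDc 0
      rw [hnab0, smul_zero, add_zero, charlier_zero] at h
      rw [hq0, h]
    · have hl : lam (n + 1) = lam n + γ (n + 1) := by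
        have h := eval_charlier_succ_add_one (-a) k (-((n + 1 : ℕ) : ℝ))
        rw [show -((n + 1 : ℕ) : ℝ) + 1 = -(n : ℝ) by push_cast; ring] at h
        rw [hlam, hlam, hγ, h]
        ring
      rw [hq, ← smul_eq_C_mul, map_add, map_smul, hDc, hDc, eq_sub_of_add_eq' (hnabs n), hl,
        ← hβγ]
      module
end

section
/- Let k ≥ 1 and let P₁ be a real polynomial of degree k+1; let a ∉ {0,1} and c be real, and set P₂(x) = P₁(x+a−1) − P₁(x), a polynomial of degree k. Assume P₂(n(a−1)) ≠ 0 for all n ≥ 0. Define γ_{n+1} = P₂(n(a−1)) for n ≥ 0, λ_n = P₁(n(a−1)) for n ≥ 0, β_{n,1} = −γ_{n+1}/γ_n and β_{n,2} = −(1/a)·γ_{n+1}/γ_n for n ≥ 1, and the polynomials q_{0,i} = 1 and q_{n,i}(x) = m_n^{a,c}(x) + β_{n,i}·m_{n−1}^{a,c}(x) for n ≥ 1, i = 1,2. Let D₁ = P₁(D_{a,c}) + (a/(1−a))·Δ ∘ P₂(D_{a,c}) and D₂ = P₁(D_{a,c}) + (1/(1−a))·∇ ∘ P₂(D_{a,c}).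 Then D_i(q_{n,i}) = λ_n·q_{n,i} for all n ≥ 0 and i = 1,2. -/
open Polynomial

/-- The generalized binomial coefficient `binom(y, j) = y(y-1)⋯(y-j+1)/j!` as a polynomial
in the (polynomial) argument `y`. -/
noncomputable def pbinom (y : ℝ[X]) (j : ℕ) : ℝ[X] :=
  C ((j.factorial : ℝ))⁻¹ * ∏ i ∈ Finset.range j, (y - C (i : ℝ))

/-- The Meixner polynomial `m_n^{a,c}(x) = (-1)^n ∑_{j=0}^n a^{-j} binom(x,j) binom(-x-c, n-j)`. -/
noncomputable def meixner (a c : ℝ) (n : ℕ) : ℝ[X] :=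
  C ((-1:ℝ)^n) * ∑ j ∈ Finset.range (n+1),
    C (a⁻¹ ^ j) * pbinom X j * pbinom (-X - C c) (n-j)

/-- The generalized binomial coefficient of a real number. -/
noncomputable def realBinom (y : ℝ) (j : ℕ) : ℝ :=
  ((j.factorial : ℝ))⁻¹ * ∏ i ∈ Finset.range j, (y - (i : ℝ))

lemma eval_pbinom (p : ℝ[X]) (j : ℕ) (x : ℝ) :
    (pbinom p j).eval x = realBinom (p.eval x) j := by
  simp [pbinom, realBinom, eval_prod]

lemma realBinom_zero (y : ℝ) : realBinom y 0 = 1 := by simp [realBinom]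

lemma realBinom_pascal (y : ℝ) (j : ℕ) :
    realBinom (y + 1) (j + 1) = realBinom y (j + 1) + realBinom y j := by
  have hj : (j.factorial : ℝ) ≠ 0 := by exact_mod_cast j.factorial_ne_zero
  have hj' : (j : ℝ) + 1 ≠ 0 := by positivity
  have h : ∀ i : ℕ, y + 1 - ((i + 1 : ℕ) : ℝ) = y - i := fun i => by push_cast; ring
  unfold realBinom
  rw [Finset.prod_range_succ', Finset.prod_range_succ]
  simp only [h, Nat.factorial_succ]
  push_cast
  field_simp
  ring

lemma realBinom_absorb (y : ℝ) (j : ℕ) :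
    realBinom y (j + 1) * (j + 1) = y * realBinom (y - 1) j := by
  have hj : (j.factorial : ℝ) ≠ 0 := by exact_mod_cast j.factorial_ne_zero
  have hj' : (j : ℝ) + 1 ≠ 0 := by positivity
  have h : ∀ i : ℕ, y - ((i + 1 : ℕ) : ℝ) = y - 1 - i := fun i => by push_cast; ring
  unfold realBinom
  rw [Finset.prod_range_succ']
  simp only [h, Nat.factorial_succ]
  push_cast
  field_simp
  ring

/-- The formal power series `(1 + s z) ^ y`. -/
noncomputable def binomPow (s y : ℝ) : PowerSeries ℝ :=
  PowerSeries.mk fun j => s ^ j * realBinom y j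

lemma binomPow_add_one (s y : ℝ) :
    binomPow s (y + 1) = (1 + PowerSeries.C s * PowerSeries.X) * binomPow s y := by
  ext n
  rw [add_mul, one_mul, mul_assoc, map_add, PowerSeries.coeff_C_mul]
  cases n with
  | zero => simp [binomPow, realBinom_zero]
  | succ n =>
    rw [PowerSeries.coeff_succ_X_mul]
    simp only [binomPow, PowerSeries.coeff_mk, realBinom_pascal]
    ring

lemma derivative_binomPow (s y : ℝ) :
    PowerSeries.derivative ℝ (binomPow s y) = PowerSeries.C (s * y) * binomPow s (y - 1) := by
  ext n
  rw [PowerSeries.coeff_derivative, PowerSeries.coeff_C_mul]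
  simp only [binomPow, PowerSeries.coeff_mk]
  linear_combination s ^ (n + 1) * realBinom_absorb y n

/-- The generating function `(1 - z / a) ^ x (1 - z) ^ (-x - c)` of the Meixner polynomials
at a point `x`. -/
noncomputable def meixnerGen (a c x : ℝ) : PowerSeries ℝ :=
  binomPow (-a⁻¹) x * binomPow (-1) (-x - c)

lemma coeff_meixnerGen (a c x : ℝ) (n : ℕ) :
    PowerSeries.coeff n (meixnerGen a c x) = (meixner a c n).eval x := by
  rw [meixnerGen, PowerSeries.coeff_mul, Finset.Nat.sum_antidiagonal_eq_sum_range_succ_mk,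
    meixner, eval_mul, eval_finsetSum, eval_C, Finset.mul_sum]
  refine Finset.sum_congr rfl fun j hj => ?_
  obtain ⟨i, rfl⟩ := Nat.exists_eq_add_of_le (Finset.mem_range_succ_iff.mp hj)
  simp only [binomPow, PowerSeries.coeff_mk, eval_mul, eval_C, eval_pbinom, eval_X, eval_sub,
    eval_neg, Nat.add_sub_cancel_left]
  rw [neg_pow a⁻¹ j, pow_add]
  ring

lemma meixnerGen_shift (a c x : ℝ) :
    (1 - PowerSeries.X) * meixnerGen a c (x + 1) =
      (1 - PowerSeries.C a⁻¹ * PowerSeries.X) * meixnerGen a c x := by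
  have hA := binomPow_add_one (-a⁻¹) x
  have hB := binomPow_add_one (-1) (-(x + 1) - c)
  rw [show -(x + 1) - c + 1 = -x - c by ring] at hB
  simp only [meixnerGen, hA, hB, map_neg, map_one]
  ring

lemma meixner_shift (a c x : ℝ) (n : ℕ) :
    (meixner a c (n + 1)).eval (x + 1) - (meixner a c n).eval (x + 1) =
      (meixner a c (n + 1)).eval x - a⁻¹ * (meixner a c n).eval x := by
  have h := congrArg (PowerSeries.coeff (n + 1)) (meixnerGen_shift a c x)
  simpa only [sub_mul, one_mul, mul_assoc, map_sub, PowerSeries.coeff_C_mul,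
    PowerSeries.coeff_succ_X_mul, coeff_meixnerGen] using h

lemma meixnerGen_differential_eq {a : ℝ} (ha : a ≠ 0) (c x : ℝ) :
    PowerSeries.C x * meixnerGen a c (x - 1)
        - PowerSeries.C ((1 + a) * x + a * c) * meixnerGen a c x
        + PowerSeries.C (a * (x + c)) * meixnerGen a c (x + 1) =
      PowerSeries.C (a - 1) *
        (PowerSeries.X * PowerSeries.derivative ℝ (meixnerGen a c x)) := by
  have hA := binomPow_add_one (-a⁻¹) (x - 1)
  have hA' := binomPow_add_one (-a⁻¹) x
  have hB := binomPow_add_one (-1) (-(x + 1) - c)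
  have hB' := binomPow_add_one (-1) (-x - c)
  have hdA := derivative_binomPow (-a⁻¹) x
  have hdB := derivative_binomPow (-1) (-x - c)
  rw [sub_add_cancel] at hA
  rw [show -(x + 1) - c + 1 = -x - c by ring] at hB
  rw [show -x - c + 1 = -(x - 1) - c by ring] at hB'
  rw [show -x - c - 1 = -(x + 1) - c by ring] at hdB
  have hinv : PowerSeries.C a * PowerSeries.C a⁻¹ = 1 := by
    rw [← map_mul, mul_inv_cancel₀ ha, map_one]
  simp only [meixnerGen, Derivation.leibniz, smul_eq_mul, hdA, hdB]
  simp only [hA', hB', hA, hB,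
    map_neg, map_one, map_mul, map_add, map_sub]
  generalize binomPow (-a⁻¹) (x - 1) = A
  generalize binomPow (-1) (-(x + 1) - c) = B
  generalize PowerSeries.C a⁻¹ = b at *
  generalize PowerSeries.C a = a' at *
  generalize PowerSeries.C x = x' at *
  generalize PowerSeries.C c = c' at *
  generalize (PowerSeries.X : PowerSeries ℝ) = z at *
  linear_combination A * B * z * (x' * (1 - z) - (x' + c') * (1 - b * z)) * hinv

lemma meixner_difference_eq {a : ℝ} (ha : a ≠ 0) (c x : ℝ) (n : ℕ) :
    x * (meixner a c n).eval (x - 1) - ((1 + a) * x + a * c) * (meixner a c n).eval x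
        + a * (x + c) * (meixner a c n).eval (x + 1) =
      n * (a - 1) * (meixner a c n).eval x := by
  have h := congrArg (PowerSeries.coeff n) (meixnerGen_differential_eq ha c x)
  simp only [map_add (PowerSeries.coeff n), map_sub (PowerSeries.coeff n), PowerSeries.coeff_C_mul,
    coeff_meixnerGen] at h
  cases n with
  | zero => simpa using h
  | succ n =>
    rw [PowerSeries.coeff_succ_X_mul, PowerSeries.coeff_derivative, coeff_meixnerGen] at h
    push_cast
    linear_combination h

lemma aeval_apply_of_eigen {T : Module.End ℝ ℝ[X]} {f : ℝ[X]} {μ : ℝ} (h : T f = μ • f)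
    (P : ℝ[X]) : aeval T P f = P.eval μ • f := by
  induction P using Polynomial.induction_on' with
  | add p q hp hq => simp [hp, hq, add_smul]
  | monomial n r =>
    have hpow : (T ^ n) f = μ ^ n • f := by
      induction n with
      | zero => simp
      | succ n ih => rw [pow_succ, Module.End.mul_apply, h, map_smul, ih, smul_smul, pow_succ']
    rw [aeval_monomial, Module.End.mul_apply, hpow, eval_monomial,
      Module.algebraMap_end_apply, smul_smul]

lemma meixner_zero (a c : ℝ) : meixner a c 0 = 1 := by
  simp [meixner, pbinom]

/-- Theorem 5.2: the polynomials `q_{n,i} = m_n^{a,c} + β_{n,i} m_{n-1}^{a,c}` are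
eigenfunctions of `D₁ = P₁(D_{a,c}) + (a/(1-a)) Δ P₂(D_{a,c})` and
`D₂ = P₁(D_{a,c}) + (1/(1-a)) ∇ P₂(D_{a,c})` respectively. -/
theorem stmt10 (k : ℕ) (hk : 1 ≤ k)
    (a : ℝ) (ha0 : a ≠ 0) (ha1 : a ≠ 1) (c : ℝ)
    (P₁ P₂ : ℝ[X]) (hdegP₁ : P₁.degree = (k+1 : ℕ))
    (hP₂ : P₂ = P₁.comp (X + C (a-1)) - P₁)
    (hnz : ∀ n : ℕ, P₂.eval ((n : ℝ) * (a-1)) ≠ 0)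
    (γ lam β₁ β₂ : ℕ → ℝ)
    (hγ : ∀ n : ℕ, γ (n+1) = P₂.eval ((n : ℝ) * (a-1)))
    (hlam : ∀ n : ℕ, lam n = P₁.eval ((n : ℝ) * (a-1)))
    (hβ₁ : ∀ n : ℕ, 1 ≤ n → β₁ n = -(γ (n+1) / γ n))
    (hβ₂ : ∀ n : ℕ, 1 ≤ n → β₂ n = -(1/a) * (γ (n+1) / γ n))
    (q₁ q₂ : ℕ → ℝ[X]) (hq₁0 : q₁ 0 = 1) (hq₂0 : q₂ 0 = 1)
    (hq₁ : ∀ n : ℕ, q₁ (n+1) = meixner a c (n+1) + C (β₁ (n+1)) * meixner a c n)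
    (hq₂ : ∀ n : ℕ, q₂ (n+1) = meixner a c (n+1) + C (β₂ (n+1)) * meixner a c n)
    (Dac : Module.End ℝ ℝ[X])
    (hDac : ∀ f : ℝ[X], ∀ x : ℝ, (Dac f).eval x =
      x * f.eval (x-1) - ((1+a)*x + a*c) * f.eval x + a*(x+c) * f.eval (x+1))
    (del nab : Module.End ℝ ℝ[X])
    (hdel : ∀ f : ℝ[X], ∀ x : ℝ, (del f).eval x = f.eval (x+1) - f.eval x)
    (hnab : ∀ f : ℝ[X], ∀ x : ℝ, (nab f).eval x = f.eval x - f.eval (x-1))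
    (D₁ D₂ : Module.End ℝ ℝ[X])
    (hD₁ : D₁ = aeval Dac P₁ + (a/(1-a)) • (del * aeval Dac P₂))
    (hD₂ : D₂ = aeval Dac P₁ + (1/(1-a)) • (nab * aeval Dac P₂)) :
    (∀ n : ℕ, D₁ (q₁ n) = lam n • q₁ n) ∧ (∀ n : ℕ, D₂ (q₂ n) = lam n • q₂ n) := by
  have heig : ∀ n : ℕ, Dac (meixner a c n) = ((n : ℝ) * (a - 1)) • meixner a c n := fun n =>
    Polynomial.funext fun x => by
      rw [hDac, meixner_difference_eq ha0, eval_smul, smul_eq_mul]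
  have hP : ∀ (P : ℝ[X]) (n : ℕ), aeval Dac P (meixner a c n) =
      P.eval ((n : ℝ) * (a - 1)) • meixner a c n := fun P n => aeval_apply_of_eigen (heig n) P
  have hstep : ∀ n : ℕ, lam (n + 1) = lam n + γ (n + 1) := fun n => by
    rw [hlam, hlam, hγ, hP₂, eval_sub, eval_comp, eval_add, eval_X, eval_C]
    push_cast
    rw [show ((n : ℝ) + 1) * (a - 1) = n * (a - 1) + (a - 1) by ring]
    ring
  have hγ0 : ∀ n : ℕ, γ (n + 1) ≠ 0 := fun n => by rw [hγ]; exact hnz n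
  have h1a : 1 - a ≠ 0 := sub_ne_zero.mpr (Ne.symm ha1)
  have hr : a / (1 - a) * (1 - a⁻¹) = -1 := by
    field_simp
    ring
  have hr' : 1 / (1 - a) * (1 - a⁻¹) = -a⁻¹ := by
    field_simp
    ring
  constructor
  · rintro (_ | n)
    · have h := fun P => hP P 0
      simp only [meixner_zero] at h
      refine Polynomial.funext fun x => ?_
      simp [hq₁0, hD₁, h, hdel, hlam]
    · have hβγ : β₁ (n + 1) * γ (n + 1) = -γ (n + 2) := by
        rw [hβ₁ _ (Nat.le_add_left 1 n)]
        have := hγ0 n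
        field_simp
      refine Polynomial.funext fun x => ?_
      have hs := meixner_shift a c x n
      simp only [hq₁, hD₁, ← smul_eq_C_mul, LinearMap.add_apply, LinearMap.smul_apply,
        Module.End.mul_apply, map_add, map_smul, hP, eval_add, eval_smul, hdel, smul_eq_mul,
        ← hlam, ← hγ]
      rw [hstep n]
      linear_combination a / (1 - a) * γ (n + 2) * hs +
        (a / (1 - a) * ((meixner a c n).eval (x + 1) - (meixner a c n).eval x)
          - (meixner a c n).eval x) * hβγ + γ (n + 2) * (meixner a c n).eval x * hr
  · rintro (_ | n)
    · have h := fun P => hP P 0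
      simp only [meixner_zero] at h
      refine Polynomial.funext fun x => ?_
      simp [hq₂0, hD₂, h, hnab, hlam]
    · have hβγ : β₂ (n + 1) * γ (n + 1) = -(a⁻¹ * γ (n + 2)) := by
        rw [hβ₂ _ (Nat.le_add_left 1 n)]
        have := hγ0 n
        field_simp
      refine Polynomial.funext fun x => ?_
      have hs := meixner_shift a c (x - 1) n
      rw [sub_add_cancel] at hs
      simp only [hq₂, hD₂, ← smul_eq_C_mul, LinearMap.add_apply, LinearMap.smul_apply,
        Module.End.mul_apply, map_add, map_smul, hP, eval_add, eval_smul, hnab, smul_eq_mul,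
        ← hlam, ← hγ]
      rw [hstep n]
      linear_combination 1 / (1 - a) * γ (n + 2) * hs +
        (1 / (1 - a) * ((meixner a c n).eval x - (meixner a c n).eval (x - 1))
          - (meixner a c n).eval x) * hβγ + γ (n + 2) * (meixner a c n).eval x * hr'
end

section
/- Let k ≥ 1 be an integer, let a be real with 0 < |a| < 1, and let c be a real number such that c − k − 1 is not a nonpositive integer, and assume m_k^{1/a, 2−c}(−n) ≠ 0 for all integers n ≥ 1. Define γ_n = m_k^{1/a,2−c}(−n), β_n = −γ_{n+1}/γ_n for n ≥ 1, and the polynomials q_0 = 1, q_n(x) = m_n^{a,c}(x) + β_n·m_{n−1}^{a,c}(x) for n ≥ 1. Let B be the bilinear form on ℝ[X] given by B(p,q) = Σ_{x=0}^{∞} [a^x·Γ(x+c)/((x+c−k−1)·x!)]·p(x)·q(x) (the series converges absolutely). Then the polynomials (q_n)_n are orthogonal with respect to B: B(q_n, X^m) = 0 for 0 ≤ m < n and B(q_n, X^n) ≠ 0. -/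
open Polynomial

/-! ### Contiguity relations for Meixner polynomials -/

/-- The power series `(1 + αX)^u = ∑ j, α^j * binom(u, j) * X^j`. -/
noncomputable def binomPS (α u : ℝ) : PowerSeries ℝ :=
  PowerSeries.mk fun j => α ^ j * Ring.choose u j

lemma binomPS_add_one (α u : ℝ) :
    binomPS α (u + 1) = (1 + PowerSeries.C α * PowerSeries.X) * binomPS α u := by
  ext (_ | j)
  · simp [binomPS, add_mul, mul_assoc]
  · simp only [binomPS, add_mul, one_mul, mul_assoc, map_add, PowerSeries.coeff_C_mul,
      PowerSeries.coeff_succ_X_mul, PowerSeries.coeff_mk, Ring.choose_succ_succ]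
    ring

lemma derivative_binomPS (α u : ℝ) :
    PowerSeries.derivative ℝ (binomPS α u) = PowerSeries.C (α * u) * binomPS α (u - 1) := by
  ext j
  have h := Ring.choose_smul_choose u (Nat.le_add_left 1 j)
  simp only [Nat.choose_one_right, nsmul_eq_mul, Ring.choose_one_right, Nat.cast_add, Nat.cast_one,
    Nat.add_sub_cancel] at h
  simp only [PowerSeries.coeff_derivative, binomPS, PowerSeries.coeff_C_mul, PowerSeries.coeff_mk]
  linear_combination α ^ (j + 1) * h

lemma pbinom_eval (p : ℝ[X]) (j : ℕ) (x : ℝ) :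
    (pbinom p j).eval x = Ring.choose (p.eval x) j := by
  rw [pbinom, Ring.choose_eq_smul, ← aeval_eq_smeval, aeval_def, ← eval_map, descPochhammer_map,
    descPochhammer_eval_eq_prod_range]
  simp [eval_prod]

lemma meixner_eval (a c : ℝ) (n : ℕ) (x : ℝ) :
    (meixner a c n).eval x =
      (-1) ^ n * PowerSeries.coeff n (binomPS a⁻¹ x * binomPS 1 (-x - c)) := by
  rw [meixner, PowerSeries.coeff_mul, Finset.Nat.sum_antidiagonal_eq_sum_range_succ_mk]
  simp [eval_finsetSum, pbinom_eval, binomPS]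

lemma meixner_eval_add_one_sub (a c : ℝ) (n : ℕ) (x : ℝ) :
    (meixner a c (n + 1)).eval (x + 1) - (meixner a c (n + 1)).eval x =
      (1 - a⁻¹) * (meixner a (c + 1) n).eval x := by
  simp only [meixner_eval]
  rw [binomPS_add_one, show -x - c = (-x - (c + 1)) + 1 by ring, binomPS_add_one,
    show -(x + 1) - c = -x - (c + 1) by ring]
  simp only [add_mul, mul_add, one_mul, map_add, mul_assoc, PowerSeries.coeff_C_mul,
    PowerSeries.coeff_succ_X_mul, mul_left_comm (binomPS a⁻¹ x)]
  ring

lemma meixner_contiguous (a c : ℝ) (n : ℕ) :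
    meixner a (c + 1) (n + 1) = meixner a c (n + 1) + meixner a (c + 1) n := by
  refine Polynomial.funext fun x => ?_
  simp only [eval_add, meixner_eval]
  rw [show -x - c = (-x - (c + 1)) + 1 by ring, binomPS_add_one]
  simp only [add_mul, mul_add, one_mul, map_add, mul_assoc, PowerSeries.coeff_C_mul,
    PowerSeries.coeff_succ_X_mul, mul_left_comm (binomPS a⁻¹ x)]
  ring

lemma meixner_succ_eval (a c : ℝ) (n : ℕ) (x : ℝ) :
    (n + 1) * (meixner a c (n + 1)).eval x = (x + c) * (meixner a (c + 1) n).eval x -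
      a⁻¹ * x * (meixner a (c + 1) n).eval (x - 1) := by
  have h := congrArg (PowerSeries.coeff n)
    (Derivation.leibniz (PowerSeries.derivative ℝ) (binomPS a⁻¹ x) (binomPS 1 (-x - c)))
  simp only [PowerSeries.coeff_derivative, derivative_binomPS, smul_eq_mul, map_add,
    PowerSeries.coeff_C_mul, mul_left_comm (binomPS _ _) (PowerSeries.C _)] at h
  rw [mul_comm (binomPS 1 _)] at h
  simp only [meixner_eval]
  rw [show -x - (c + 1) = -x - c - 1 by ring, show -(x - 1) - (c + 1) = -x - c by ring]
  linear_combination (-1) ^ (n + 1) * h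

/-! ### Moments of a discrete weight -/

/-- The functional `p ↦ ∑ x, v x * p x` attached to a weight on the natural numbers. -/
noncomputable def moment (v : ℕ → ℝ) (p : ℝ[X]) : ℝ := ∑' x : ℕ, v x * p.eval (x : ℝ)

/-- All polynomials are summable against `v`. -/
def HasMoments (v : ℕ → ℝ) : Prop := ∀ p : ℝ[X], Summable fun x : ℕ => v x * p.eval (x : ℝ)

lemma moment_C_mul (v : ℕ → ℝ) (b : ℝ) (p : ℝ[X]) : moment v (C b * p) = b * moment v p := by
  simp only [moment, ← tsum_mul_left]
  exact tsum_congr fun x => by simp; ring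

namespace HasMoments

variable {v w : ℕ → ℝ}

lemma of_pow (h : ∀ m : ℕ, Summable fun x : ℕ => v x * (x : ℝ) ^ m) : HasMoments v := by
  intro p
  simp only [eval_eq_sum_range, Finset.mul_sum]
  refine summable_sum fun i _ => ((h i).mul_left (p.coeff i)).congr fun x => by ring

lemma moment_add (hv : HasMoments v) (p r : ℝ[X]) :
    moment v (p + r) = moment v p + moment v r := by
  rw [moment, moment, moment, ← (hv p).tsum_add (hv r)]
  exact tsum_congr fun x => by simp [mul_add]

lemma moment_sub (hv : HasMoments v) (p r : ℝ[X]) :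
    moment v (p - r) = moment v p - moment v r := by
  rw [moment, moment, moment, ← (hv p).tsum_sub (hv r)]
  exact tsum_congr fun x => by simp [mul_sub]

lemma moment_sum (hv : HasMoments v) {ι : Type*} (s : Finset ι) (f : ι → ℝ[X]) :
    moment v (∑ i ∈ s, f i) = ∑ i ∈ s, moment v (f i) := by
  simp only [moment, eval_finsetSum, Finset.mul_sum]
  exact Summable.tsum_finsetSum fun i _ => hv (f i)

lemma add_const_mul (hv : HasMoments v) (hw : HasMoments w) (b : ℝ) :
    HasMoments fun x => v x + b * w x := fun p =>
  ((hv p).add ((hw p).mul_left b)).congr fun x => by ring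

lemma moment_add_const_mul (hv : HasMoments v) (hw : HasMoments w) (b : ℝ) (p : ℝ[X]) :
    moment (fun x => v x + b * w x) p = moment v p + b * moment w p := by
  rw [moment, moment, moment, ← tsum_mul_left, ← (hv p).tsum_add ((hw p).mul_left b)]
  exact tsum_congr fun x => by ring

end HasMoments

/-! ### The Meixner weight -/

/-- The Meixner weight `a^x Γ(x+c) / x!`. -/
noncomputable def meixnerWeight (a c : ℝ) (x : ℕ) : ℝ :=
  a ^ x * Real.Gamma (x + c) / x.factorial

section Weight

variable {a c : ℝ}

lemma natCast_add_ne_zero (hc : ∀ m : ℕ, c ≠ -(m : ℝ)) (x : ℕ) : (x : ℝ) + c ≠ 0 :=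
  fun h => hc x (by linarith)

lemma add_one_ne_neg_natCast (hc : ∀ m : ℕ, c ≠ -(m : ℝ)) (m : ℕ) : c + 1 ≠ -(m : ℝ) :=
  fun h => hc (m + 1) (by push_cast; linarith)

lemma add_natCast_ne_neg_natCast (hc : ∀ m : ℕ, c ≠ -(m : ℝ)) (k m : ℕ) : c + k ≠ -(m : ℝ) :=
  fun h => hc (m + k) (by push_cast; linarith)

lemma meixnerWeight_add_one (hc : ∀ m : ℕ, c ≠ -(m : ℝ)) (x : ℕ) :
    meixnerWeight a (c + 1) x = (x + c) * meixnerWeight a c x := by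
  rw [meixnerWeight, meixnerWeight, ← add_assoc, Real.Gamma_add_one (natCast_add_ne_zero hc x)]
  ring

lemma succ_mul_meixnerWeight_succ (x : ℕ) :
    meixnerWeight a c (x + 1) * (x + 1) = a * meixnerWeight a (c + 1) x := by
  have h : (x : ℝ) + 1 ≠ 0 := by positivity
  simp only [meixnerWeight, Nat.factorial_succ, Nat.cast_mul, Nat.cast_add, Nat.cast_one,
    show (x : ℝ) + (c + 1) = x + 1 + c by ring, pow_succ]
  field_simp

lemma meixnerWeight_eq_choose (hc : ∀ m : ℕ, c ≠ -(m : ℝ)) (x : ℕ) :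
    meixnerWeight a c x = Real.Gamma c * (Ring.choose (c + x - 1) x * a ^ x) := by
  induction x with
  | zero => simp [meixnerWeight]
  | succ x ih =>
    have h := Ring.choose_smul_choose (c + x) (Nat.le_add_left 1 x)
    simp only [Nat.choose_one_right, nsmul_eq_mul, Ring.choose_one_right, Nat.cast_add,
      Nat.cast_one, Nat.add_sub_cancel] at h
    have h' : (x : ℝ) + 1 ≠ 0 := by positivity
    have h2 := succ_mul_meixnerWeight_succ (a := a) (c := c) x
    rw [meixnerWeight_add_one hc, ih] at h2
    refine mul_right_cancel₀ h' (h2.trans ?_)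
    rw [Nat.cast_add, Nat.cast_one, show c + ((x : ℝ) + 1) - 1 = c + x by ring]
    linear_combination -(Real.Gamma c * a ^ (x + 1)) * h

lemma hasSum_meixnerWeight (ha : |a| < 1) (hc : ∀ m : ℕ, c ≠ -(m : ℝ)) :
    HasSum (meixnerWeight a c) (Real.Gamma c * (1 / (1 - a) ^ c)) := by
  have h := (Real.one_div_one_sub_rpow_hasFPowerSeriesOnBall_zero c).hasSum (y := a)
    (by simpa [enorm_eq_nnnorm, ← NNReal.coe_lt_coe] using ha)
  simp only [zero_add, FormalMultilinearSeries.ofScalars_apply_eq, smul_eq_mul] at h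
  exact (h.mul_left (Real.Gamma c)).congr_fun fun x => meixnerWeight_eq_choose hc x

lemma hasMoments_meixnerWeight (ha : |a| < 1) (hc : ∀ m : ℕ, c ≠ -(m : ℝ)) :
    HasMoments (meixnerWeight a c) := by
  refine .of_pow fun m => ?_
  induction m generalizing c with
  | zero => simpa using (hasSum_meixnerWeight ha hc).summable
  | succ m ih =>
    refine ((ih (add_one_ne_neg_natCast hc)).sub ((ih hc).mul_left c)).congr fun x => ?_
    rw [meixnerWeight_add_one hc]
    ring

lemma moment_meixnerWeight_one_ne_zero (ha : |a| < 1) (hc : ∀ m : ℕ, c ≠ -(m : ℝ)) :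
    moment (meixnerWeight a c) 1 ≠ 0 := by
  simp only [moment, eval_one, mul_one, (hasSum_meixnerWeight ha hc).tsum_eq]
  have : 0 < (1 - a) ^ c := Real.rpow_pos_of_pos (by linarith [(abs_lt.mp ha).2]) c
  exact mul_ne_zero (Real.Gamma_ne_zero hc) (by positivity)

lemma moment_X_add_C_mul (hc : ∀ m : ℕ, c ≠ -(m : ℝ)) (p : ℝ[X]) :
    moment (meixnerWeight a c) ((X + C c) * p) = moment (meixnerWeight a (c + 1)) p :=
  tsum_congr fun x => by simp [meixnerWeight_add_one hc]; ring

lemma moment_X_mul (ha : |a| < 1) (hc : ∀ m : ℕ, c ≠ -(m : ℝ)) (p : ℝ[X]) :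
    moment (meixnerWeight a c) (X * p) = a * moment (meixnerWeight a (c + 1)) (p.comp (X + 1)) := by
  rw [moment, (hasMoments_meixnerWeight ha hc _).tsum_eq_zero_add, moment, ← tsum_mul_left]
  simp only [Nat.cast_zero, eval_mul, eval_X, zero_mul, mul_zero, zero_add, eval_comp, eval_add,
    eval_one, Nat.cast_add, Nat.cast_one]
  refine tsum_congr fun x => ?_
  linear_combination
    p.eval ((x : ℝ) + 1) * succ_mul_meixnerWeight_succ (a := a) (c := c) x

lemma moment_add_one_one (ha : |a| < 1) (hc : ∀ m : ℕ, c ≠ -(m : ℝ)) :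
    (1 - a) * moment (meixnerWeight a (c + 1)) 1 = c * moment (meixnerWeight a c) 1 := by
  have h1 := moment_X_add_C_mul (a := a) hc 1
  have h2 := moment_X_mul ha hc 1
  rw [add_mul, (hasMoments_meixnerWeight ha hc).moment_add, h2, moment_C_mul, one_comp] at h1
  linear_combination -h1

lemma moment_meixner_succ_mul (ha0 : a ≠ 0) (ha : |a| < 1) (hc : ∀ m : ℕ, c ≠ -(m : ℝ))
    (n : ℕ) (r : ℝ[X]) :
    (n + 1) * moment (meixnerWeight a c) (meixner a c (n + 1) * r) =
      -moment (meixnerWeight a (c + 1)) (meixner a (c + 1) n * (r.comp (X + 1) - r)) := by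
  have hm := hasMoments_meixnerWeight ha hc
  have h : C ((n : ℝ) + 1) * (meixner a c (n + 1) * r) =
      (X + C c) * (meixner a (c + 1) n * r) -
        C a⁻¹ * (X * ((meixner a (c + 1) n).comp (X - 1) * r)) := by
    refine Polynomial.funext fun x => ?_
    have := meixner_succ_eval a c n x
    simp only [eval_mul, eval_C, eval_sub, eval_add, eval_X, eval_comp, eval_one]
    linear_combination r.eval x * this
  rw [← moment_C_mul, h, hm.moment_sub, moment_X_add_C_mul hc, moment_C_mul, moment_X_mul ha hc,
    inv_mul_cancel_left₀ ha0, mul_sub,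
    (hasMoments_meixnerWeight ha (add_one_ne_neg_natCast hc)).moment_sub, mul_comp, comp_assoc]
  simp

lemma X_pow_comp_X_add_one_sub (m : ℕ) :
    (X ^ m : ℝ[X]).comp (X + 1) - X ^ m = ∑ i ∈ Finset.range m, C (m.choose i : ℝ) * X ^ i := by
  rw [X_pow_comp, add_pow, Finset.sum_range_succ]
  simp [mul_comm]

lemma moment_meixner_mul_X_pow_of_lt (ha0 : a ≠ 0) (ha : |a| < 1) (hc : ∀ m : ℕ, c ≠ -(m : ℝ))
    {n m : ℕ} (h : m < n) : moment (meixnerWeight a c) (meixner a c n * X ^ m) = 0 := by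
  induction n generalizing c m with
  | zero => omega
  | succ n ih =>
    have hc' := add_one_ne_neg_natCast hc
    have key := moment_meixner_succ_mul ha0 ha hc n (X ^ m)
    rw [X_pow_comp_X_add_one_sub, Finset.mul_sum,
      (hasMoments_meixnerWeight ha hc').moment_sum, Finset.sum_eq_zero, neg_zero] at key
    · exact (mul_eq_zero.mp key).resolve_left (by positivity)
    · intro i hi
      rw [mul_left_comm, moment_C_mul, ih hc' (by have := Finset.mem_range.mp hi; omega), mul_zero]

lemma moment_meixner_succ (ha0 : a ≠ 0) (ha : |a| < 1) (hc : ∀ m : ℕ, c ≠ -(m : ℝ)) (n : ℕ) :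
    moment (meixnerWeight a c) (meixner a c (n + 1)) = 0 := by
  simpa using moment_meixner_mul_X_pow_of_lt ha0 ha hc n.succ_pos

lemma moment_meixner_mul_X_pow_self_ne_zero (ha0 : a ≠ 0) (ha : |a| < 1)
    (hc : ∀ m : ℕ, c ≠ -(m : ℝ)) (n : ℕ) :
    moment (meixnerWeight a c) (meixner a c n * X ^ n) ≠ 0 := by
  induction n generalizing c with
  | zero => simpa [meixner_zero] using moment_meixnerWeight_one_ne_zero ha hc
  | succ n ih =>
    have hc' := add_one_ne_neg_natCast hc
    have key := moment_meixner_succ_mul ha0 ha hc n (X ^ (n + 1))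
    rw [X_pow_comp_X_add_one_sub, Finset.mul_sum,
      (hasMoments_meixnerWeight ha hc').moment_sum, Finset.sum_range_succ, Finset.sum_eq_zero,
      zero_add, mul_left_comm, moment_C_mul] at key
    · intro h
      rw [h, mul_zero, eq_comm, neg_eq_zero] at key
      refine mul_ne_zero ?_ (ih hc') key
      rw [Nat.choose_succ_self_right]
      positivity
    · intro i hi
      rw [mul_left_comm, moment_C_mul,
        moment_meixner_mul_X_pow_of_lt ha0 ha hc' (Finset.mem_range.mp hi), mul_zero]

end Weight

/-! ### The Geronimus transform of the Meixner weight -/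

/-- The weight `a^x Γ(x+c) / ((x+c-k-1) x!)` in terms of `s = c - k - 1`. -/
noncomputable def geronimusWeight (a s : ℝ) (k x : ℕ) : ℝ :=
  meixnerWeight a (s + k + 1) x / (x + s)

/-- The value `m_k^{1/a,2-c}(-n)` in terms of `s = c - k - 1`. -/
noncomputable def dualValue (a s : ℝ) (k n : ℕ) : ℝ :=
  (meixner a⁻¹ (1 - s - k) k).eval (-(n : ℝ))

section Geronimus

variable {a s : ℝ}

lemma dualValue_succ_sub (k n : ℕ) :
    dualValue a s (k + 1) (n + 1) - dualValue a s (k + 1) n =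
      -(1 - a) * dualValue a s k (n + 1) := by
  have h := meixner_eval_add_one_sub a⁻¹ (1 - s - (k + 1 : ℕ)) k (-((n + 1 : ℕ) : ℝ))
  rw [show -((n + 1 : ℕ) : ℝ) + 1 = -(n : ℝ) by push_cast; ring,
    show (1 : ℝ) - s - (k + 1 : ℕ) + 1 = 1 - s - k by push_cast; ring, inv_inv] at h
  rw [dualValue, dualValue, dualValue]
  linear_combination -h

lemma succ_mul_dualValue_succ_zero (k : ℕ) :
    (k + 1) * dualValue a s (k + 1) 0 = -(s + k) * dualValue a s k 0 := by
  have h := meixner_succ_eval a⁻¹ (1 - s - (k + 1 : ℕ)) k (-((0 : ℕ) : ℝ))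
  rw [show (1 : ℝ) - s - (k + 1 : ℕ) + 1 = 1 - s - k by push_cast; ring] at h
  rw [dualValue, dualValue, h]
  push_cast
  ring

lemma geronimusWeight_zero (hs : ∀ m : ℕ, s ≠ -(m : ℝ)) :
    geronimusWeight a s 0 = meixnerWeight a s := by
  ext x
  rw [geronimusWeight, Nat.cast_zero, add_zero, meixnerWeight_add_one hs,
    mul_div_cancel_left₀ _ (natCast_add_ne_zero hs x)]

lemma geronimusWeight_succ (hs : ∀ m : ℕ, s ≠ -(m : ℝ)) (k : ℕ) :
    geronimusWeight a s (k + 1) =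
      fun x => meixnerWeight a (s + k + 1) x + (k + 1) * geronimusWeight a s k x := by
  ext x
  have hx := natCast_add_ne_zero hs x
  rw [geronimusWeight, geronimusWeight, Nat.cast_add, Nat.cast_one, ← add_assoc,
    meixnerWeight_add_one (add_one_ne_neg_natCast (add_natCast_ne_neg_natCast hs k))]
  field_simp
  ring

lemma hasMoments_geronimusWeight (ha : |a| < 1) (hs : ∀ m : ℕ, s ≠ -(m : ℝ)) (k : ℕ) :
    HasMoments (geronimusWeight a s k) := by
  induction k with
  | zero => exact geronimusWeight_zero (a := a) hs ▸ hasMoments_meixnerWeight ha hs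
  | succ k ih =>
    rw [geronimusWeight_succ hs]
    exact (hasMoments_meixnerWeight ha
      (add_one_ne_neg_natCast (add_natCast_ne_neg_natCast hs k))).add_const_mul ih _

lemma moment_geronimusWeight_succ (ha : |a| < 1) (hs : ∀ m : ℕ, s ≠ -(m : ℝ)) (k : ℕ) (p : ℝ[X]) :
    moment (geronimusWeight a s (k + 1)) p =
      moment (meixnerWeight a (s + k + 1)) p + (k + 1) * moment (geronimusWeight a s k) p := by
  rw [geronimusWeight_succ hs]
  exact (hasMoments_meixnerWeight ha
    (add_one_ne_neg_natCast (add_natCast_ne_neg_natCast hs k))).moment_add_const_mul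
      (hasMoments_geronimusWeight ha hs k) _ p

lemma moment_geronimusWeight_mul_X (ha : |a| < 1) (hs : ∀ m : ℕ, s ≠ -(m : ℝ)) (k : ℕ)
    (p : ℝ[X]) :
    moment (geronimusWeight a s k) (p * X) =
      moment (meixnerWeight a (s + k + 1)) p - s * moment (geronimusWeight a s k) p := by
  have h : moment (geronimusWeight a s k) (p * X + C s * p) =
      moment (meixnerWeight a (s + k + 1)) p := tsum_congr fun x => by
    have hx := natCast_add_ne_zero hs x
    simp only [geronimusWeight, eval_add, eval_mul, eval_X, eval_C]
    field_simp
  rw [(hasMoments_geronimusWeight ha hs k).moment_add, moment_C_mul] at h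
  linear_combination h

/-- The constant relating `dualValue` to the moments of the Geronimus weight. -/
noncomputable def dualConst (a s : ℝ) (k : ℕ) : ℝ :=
  (-1) ^ k * k.factorial / (1 - a) ^ k * moment (meixnerWeight a s) 1

lemma dualConst_succ (ha : |a| < 1) (k : ℕ) :
    (1 - a) * dualConst a s (k + 1) = -(k + 1) * dualConst a s k := by
  have : 1 - a ≠ 0 := by linarith [(abs_lt.mp ha).2]
  simp only [dualConst, Nat.factorial_succ, pow_succ]
  push_cast
  field_simp

lemma dualConst_ne_zero (ha : |a| < 1) (hs : ∀ m : ℕ, s ≠ -(m : ℝ)) (k : ℕ) :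
    dualConst a s k ≠ 0 := by
  have h : 0 < 1 - a := by linarith [(abs_lt.mp ha).2]
  have := moment_meixnerWeight_one_ne_zero ha hs
  have := k.factorial_ne_zero
  unfold dualConst
  positivity

lemma moment_meixnerWeight_add_natCast_one (ha : |a| < 1) (hs : ∀ m : ℕ, s ≠ -(m : ℝ)) (k : ℕ) :
    moment (meixnerWeight a (s + k)) 1 = dualConst a s k * dualValue a s k 0 := by
  induction k with
  | zero => simp [dualConst, dualValue, meixner_zero]
  | succ k ih =>
    have h1 := moment_add_one_one ha (add_natCast_ne_neg_natCast hs k)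
    have h2 := dualConst_succ (s := s) ha k
    have h3 := succ_mul_dualValue_succ_zero (a := a) (s := s) k
    have h : 1 - a ≠ 0 := by linarith [(abs_lt.mp ha).2]
    rw [Nat.cast_add, Nat.cast_one, ← add_assoc]
    refine mul_left_cancel₀ h (h1.trans ?_)
    linear_combination (s + k) * ih + dualConst a s k * h3 - dualValue a s (k + 1) 0 * h2

lemma moment_geronimusWeight_meixner (ha0 : a ≠ 0) (ha : |a| < 1) (hs : ∀ m : ℕ, s ≠ -(m : ℝ))
    (k n : ℕ) :
    moment (geronimusWeight a s k) (meixner a (s + k + 1) n) =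
      dualConst a s k * dualValue a s k (n + 1) := by
  induction k generalizing n with
  | zero =>
    have h0 : dualConst a s 0 * dualValue a s 0 (n + 1) = moment (meixnerWeight a s) 1 := by
      simp [dualConst, dualValue, meixner_zero]
    rw [h0, geronimusWeight_zero hs, Nat.cast_zero, add_zero]
    clear h0
    induction n with
    | zero => rw [meixner_zero]
    | succ n ih =>
      rw [meixner_contiguous, (hasMoments_meixnerWeight ha hs).moment_add,
        moment_meixner_succ ha0 ha hs, zero_add]
      exact ih
  | succ k ihk =>
    have hc := add_one_ne_neg_natCast (add_natCast_ne_neg_natCast hs k)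
    have h2 := dualConst_succ (s := s) ha k
    induction n with
    | zero =>
      have h1 := moment_meixnerWeight_add_natCast_one ha hs (k + 1)
      have h3 := dualValue_succ_sub (a := a) (s := s) k 0
      have h4 := ihk 0
      rw [meixner_zero] at h4 ⊢
      rw [Nat.cast_add, Nat.cast_one, ← add_assoc] at h1
      rw [moment_geronimusWeight_succ ha hs, h1, h4]
      linear_combination -dualConst a s (k + 1) * h3 + dualValue a s k (0 + 1) * h2
    | succ n ihn =>
      have h3 := dualValue_succ_sub (a := a) (s := s) k (n + 1)
      rw [meixner_contiguous, (hasMoments_geronimusWeight ha hs _).moment_add, ihn,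
        moment_geronimusWeight_succ ha hs, Nat.cast_add, Nat.cast_one, ← add_assoc,
        moment_meixner_succ ha0 ha hc, ihk]
      linear_combination -dualConst a s (k + 1) * h3 + dualValue a s k (n + 1 + 1) * h2

end Geronimus

/-- Theorem 5.4 (orthogonality part): the polynomials `q_n = m_n^{a,c} + β_n m_{n-1}^{a,c}`
are orthogonal with respect to the moment functional
`ρ̃_{k,a,c} = ∑_x a^x Γ(x+c)/((x+c-k-1) x!) δ_x`. -/
theorem stmt12 (k : ℕ) (hk : 1 ≤ k) (a : ℝ) (ha : 0 < |a|) (ha1 : |a| < 1)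
    (c : ℝ) (hc : ∀ m : ℕ, c - k - 1 ≠ -(m : ℝ))
    (hnz : ∀ n : ℕ, 1 ≤ n → (meixner a⁻¹ (2-c) k).eval (-(n : ℝ)) ≠ 0)
    (γ β : ℕ → ℝ)
    (hγ : ∀ n : ℕ, γ n = (meixner a⁻¹ (2-c) k).eval (-(n : ℝ)))
    (hβ : ∀ n : ℕ, 1 ≤ n → β n = -(γ (n+1) / γ n))
    (q : ℕ → ℝ[X]) (hq0 : q 0 = 1)
    (hq : ∀ n : ℕ, q (n+1) = meixner a c (n+1) + C (β (n+1)) * meixner a c n)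
    (B : ℝ[X] → ℝ[X] → ℝ)
    (hB : ∀ p r : ℝ[X], B p r =
      ∑' x : ℕ, a^x * Real.Gamma ((x : ℝ) + c) / (((x : ℝ) + c - k - 1) * x.factorial)
        * p.eval (x : ℝ) * r.eval (x : ℝ)) :
    (∀ n m : ℕ, m < n → B (q n) (X^m) = 0) ∧ (∀ n : ℕ, B (q n) (X^n) ≠ 0) := by
  obtain ⟨s, rfl⟩ : ∃ s, c = s + k + 1 := ⟨c - k - 1, by ring⟩
  have hs : ∀ m : ℕ, s ≠ -(m : ℝ) := fun m h => hc m (by rw [← h]; ring)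
  have hc' := add_one_ne_neg_natCast (add_natCast_ne_neg_natCast hs k)
  have ha0 : a ≠ 0 := abs_pos.mp ha
  have hγ' (n : ℕ) : γ n = dualValue a s k n := by
    rw [hγ, dualValue, show (2 : ℝ) - (s + k + 1) = 1 - s - k by ring]
  have hγ0 (n : ℕ) : γ (n + 1) ≠ 0 := hγ (n + 1) ▸ hnz (n + 1) n.succ_pos
  have hB' (p r : ℝ[X]) : B p r = moment (geronimusWeight a s k) (p * r) := by
    rw [hB]
    refine tsum_congr fun x => ?_
    have hx := natCast_add_ne_zero hs x
    rw [geronimusWeight, meixnerWeight, eval_mul, show (x : ℝ) + (s + k + 1) - k - 1 = x + s by ring]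
    field_simp
  have hm := hasMoments_meixnerWeight ha1 hc'
  have hstep (p : ℝ[X]) (m : ℕ) := moment_geronimusWeight_mul_X ha1 hs k (p * X ^ m)
  have hL (n m : ℕ) : moment (meixnerWeight a (s + k + 1)) (q (n + 1) * X ^ m) =
      moment (meixnerWeight a (s + k + 1)) (meixner a (s + k + 1) (n + 1) * X ^ m) +
        β (n + 1) * moment (meixnerWeight a (s + k + 1)) (meixner a (s + k + 1) n * X ^ m) := by
    rw [hq, add_mul, hm.moment_add, mul_assoc, moment_C_mul]
  have horth (n m : ℕ) (h : m ≤ n) : moment (geronimusWeight a s k) (q (n + 1) * X ^ m) = 0 := by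
    induction m with
    | zero =>
      rw [pow_zero, mul_one, hq, (hasMoments_geronimusWeight ha1 hs k).moment_add, moment_C_mul,
        moment_geronimusWeight_meixner ha0 ha1 hs, moment_geronimusWeight_meixner ha0 ha1 hs,
        ← hγ', ← hγ', hβ _ n.succ_pos]
      have := hγ0 n
      field_simp
      ring
    | succ m ih =>
      rw [pow_succ, ← mul_assoc, hstep, ih (by omega), hL,
        moment_meixner_mul_X_pow_of_lt ha0 ha1 hc' (by omega),
        moment_meixner_mul_X_pow_of_lt ha0 ha1 hc' (by omega)]
      ring
  refine ⟨fun n m h => ?_, fun n => ?_⟩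
  · obtain ⟨n, rfl⟩ := Nat.exists_eq_add_one_of_ne_zero (Nat.ne_zero_of_lt h)
    rw [hB', horth n m (by omega)]
  · rw [hB']
    cases n with
    | zero =>
      have h := moment_geronimusWeight_meixner ha0 ha1 hs k 0
      rw [meixner_zero, ← hγ'] at h
      rw [hq0, pow_zero, mul_one, h]
      exact mul_ne_zero (dualConst_ne_zero ha1 hs k) (hγ0 0)
    | succ n =>
      rw [pow_succ, ← mul_assoc, hstep, horth n n le_rfl, hL,
        moment_meixner_mul_X_pow_of_lt ha0 ha1 hc' n.lt_succ_self, mul_zero, sub_zero, zero_add,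
        hβ _ n.succ_pos]
      exact mul_ne_zero (neg_ne_zero.mpr (div_ne_zero (hγ0 (n + 1)) (hγ0 n)))
        (moment_meixner_mul_X_pow_self_ne_zero ha0 ha1 hc' n)
end
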